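/- arXiv:0909.0578 — 2 statements merged into one kernel-verified Lean document; each statement's English description precedes it below -/
import Mathlib

section
/- Let ζ₈ = exp(2πi/8), a = diag(ζ₈, ζ₈⁷), b = [[0, i], [i, 0]], c = (1/√2)·[[ζ₈⁷, ζ₈⁷], [ζ₈⁵, ζ₈]], and let Γ ⊂ SL₂(ℂ) be the binary octahedral group, the subgroup generated by a, b, c. Then in ℂ⟦t⟧: (1 − t⁸)(1 − t¹²)·Σₙ dim_ℂ((Symⁿ(ℂ²))^Γ)·tⁿ = 1 + t¹⁸, where (Symⁿ(ℂ²))^Γ is the space of Γ-invariant vectors in the n-th symmetric power of the natural representation ℂ². -/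
open Matrix Complex PowerSeries CategoryTheory

/-- The `k`-th column image polynomial used to define the symmetric power:
the image of the basis vector `e₁^k e₂^(n-k)` of `Symⁿ(ℂ²)` under the endomorphism
induced by `g`, written as a polynomial in `X 0 ↔ e₁`, `X 1 ↔ e₂`. -/
noncomputable def symPoly2 (n : ℕ) (g : Matrix (Fin 2) (Fin 2) ℂ) (k : Fin (n + 1)) :
    MvPolynomial (Fin 2) ℂ :=
  (MvPolynomial.C (g 0 0) * MvPolynomial.X 0 + MvPolynomial.C (g 1 0) * MvPolynomial.X 1) ^ (k : ℕ) *
  (MvPolynomial.C (g 0 1) * MvPolynomial.X 0 + MvPolynomial.C (g 1 1) * MvPolynomial.X 1) ^ (n - (k : ℕ))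

/-- The matrix of the endomorphism `Symⁿ(g)` induced by `g` on the `n`-th symmetric power
of `ℂ²`, in the basis of monomials `e₁^i e₂^(n-i)`, `i = 0, …, n`. -/
noncomputable def symMatrix2 (n : ℕ) (g : Matrix (Fin 2) (Fin 2) ℂ) :
    Matrix (Fin (n + 1)) (Fin (n + 1)) ℂ :=
  Matrix.of fun i k =>
    MvPolynomial.coeff (Finsupp.single 0 (i : ℕ) + Finsupp.single 1 (n - (i : ℕ)))
      (symPoly2 n g k)

/-- The subspace of `Γ`-invariant vectors in the `n`-th symmetric power of `ℂ²`
(in the monomial-basis coordinates given by `symMatrix2`). -/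
noncomputable def symInvariants2 (Γ : Subgroup (SpecialLinearGroup (Fin 2) ℂ)) (n : ℕ) :
    Submodule ℂ (Fin (n + 1) → ℂ) where
  carrier := {v | ∀ g ∈ Γ, (symMatrix2 n (g : Matrix (Fin 2) (Fin 2) ℂ)).mulVec v = v}
  add_mem' := by
    intro a b ha hb g hg
    rw [Matrix.mulVec_add, ha g hg, hb g hg]
  zero_mem' := by
    intro g hg
    rw [Matrix.mulVec_zero]
  smul_mem' := by
    intro c x hx g hg
    rw [Matrix.mulVec_smul, hx g hg]

noncomputable def subst2 (g : Matrix (Fin 2) (Fin 2) ℂ) :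
    MvPolynomial (Fin 2) ℂ →ₐ[ℂ] MvPolynomial (Fin 2) ℂ :=
  MvPolynomial.aeval ![MvPolynomial.C (g 0 0) * MvPolynomial.X 0 +
      MvPolynomial.C (g 1 0) * MvPolynomial.X 1,
    MvPolynomial.C (g 0 1) * MvPolynomial.X 0 + MvPolynomial.C (g 1 1) * MvPolynomial.X 1]

theorem subst2_X_one (g : Matrix (Fin 2) (Fin 2) ℂ) :
    subst2 g (MvPolynomial.X 1) = MvPolynomial.C (g 0 1) * MvPolynomial.X 0 +
      MvPolynomial.C (g 1 1) * MvPolynomial.X 1 := by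
  simp [subst2]

theorem eval_subst2 (g : Matrix (Fin 2) (Fin 2) ℂ) (p : MvPolynomial (Fin 2) ℂ) (x y : ℂ) :
    MvPolynomial.eval ![x, y] (subst2 g p) =
      MvPolynomial.eval ![g 0 0 * x + g 1 0 * y, g 0 1 * x + g 1 1 * y] p := by
  induction p using MvPolynomial.induction_on with
  | C z => simp [subst2]
  | add p q hp hq => simp only [map_add, hp, hq]
  | mul_X p i hp =>
    rw [map_mul, map_mul, map_mul, hp]
    congr 1
    fin_cases i <;> simp [subst2]

theorem subst2_subst2 (g h : Matrix (Fin 2) (Fin 2) ℂ) (p : MvPolynomial (Fin 2) ℂ) :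
    subst2 g (subst2 h p) = subst2 (g * h) p := by
  suffices H : (subst2 g).comp (subst2 h) = subst2 (g * h) from DFunLike.congr_fun H p
  ext1 i
  fin_cases i <;>
  · simp [subst2, Matrix.mul_apply, Fin.sum_univ_two]
    ring

theorem subst2_one (p : MvPolynomial (Fin 2) ℂ) : subst2 1 p = p := by
  suffices H : subst2 1 = AlgHom.id ℂ _ from DFunLike.congr_fun H p
  ext1 i
  fin_cases i <;> simp [subst2]

theorem isHomogeneous_subst2 (g : Matrix (Fin 2) (Fin 2) ℂ) {p : MvPolynomial (Fin 2) ℂ} {n : ℕ}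
    (hp : p.IsHomogeneous n) : (subst2 g p).IsHomogeneous n := by
  rw [← one_mul n]
  refine hp.aeval _ fun i => ?_
  fin_cases i <;> exact (MvPolynomial.isHomogeneous_C_mul_X _ _).add
    (MvPolynomial.isHomogeneous_C_mul_X _ _)

/-- The exponent of the monomial `x ^ k * y ^ (n - k)`. -/
noncomputable def binaryExponent (n k : ℕ) : Fin 2 →₀ ℕ :=
  Finsupp.single 0 k + Finsupp.single 1 (n - k)

/-- The binary form of degree `n` with the given coefficients. -/
noncomputable def binaryForm (n : ℕ) : (Fin (n + 1) → ℂ) →ₗ[ℂ] MvPolynomial (Fin 2) ℂ :=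
  ∑ k : Fin (n + 1), (MvPolynomial.monomial (binaryExponent n k)).comp (LinearMap.proj k)

theorem binaryForm_apply (n : ℕ) (v : Fin (n + 1) → ℂ) :
    binaryForm n v = ∑ k : Fin (n + 1), MvPolynomial.monomial (binaryExponent n k) (v k) := by
  simp [binaryForm]

theorem binaryForm_eq_sum (n : ℕ) (v : Fin (n + 1) → ℂ) :
    binaryForm n v = ∑ k : Fin (n + 1),
      v k • (MvPolynomial.X 0 ^ (k : ℕ) * MvPolynomial.X 1 ^ (n - (k : ℕ))) := by
  rw [binaryForm_apply]
  refine Finset.sum_congr rfl fun k _ => ?_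
  rw [MvPolynomial.monomial_eq, binaryExponent, Finsupp.prod_fintype _ _ (by simp),
    Fin.prod_univ_two, MvPolynomial.C_mul']
  simp

theorem binaryExponent_apply_zero (n k : ℕ) : binaryExponent n k 0 = k := by
  simp [binaryExponent]

theorem coeff_binaryForm (n : ℕ) (v : Fin (n + 1) → ℂ) (i : Fin (n + 1)) :
    MvPolynomial.coeff (binaryExponent n i) (binaryForm n v) = v i := by
  rw [binaryForm_apply, MvPolynomial.coeff_sum, Finset.sum_eq_single i]
  · simp
  · intro k _ hk
    rw [MvPolynomial.coeff_monomial, if_neg]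
    intro h
    have := DFunLike.congr_fun h 0
    rw [binaryExponent_apply_zero, binaryExponent_apply_zero] at this
    exact hk (Fin.ext this)
  · simp

theorem binaryForm_injective (n : ℕ) : Function.Injective (binaryForm n) := fun v w h => by
  ext i
  rw [← coeff_binaryForm n v, h, coeff_binaryForm]

theorem isHomogeneous_binaryForm (n : ℕ) (v : Fin (n + 1) → ℂ) :
    (binaryForm n v).IsHomogeneous n := by
  rw [binaryForm_apply]
  refine MvPolynomial.IsHomogeneous.sum _ _ _ fun k _ => ?_
  refine MvPolynomial.isHomogeneous_monomial _ ?_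
  have := k.is_le
  simp [binaryExponent, Finsupp.degree_eq_sum]
  omega

theorem binaryForm_coeff {n : ℕ} {p : MvPolynomial (Fin 2) ℂ} (hp : p.IsHomogeneous n) :
    binaryForm n (fun i => MvPolynomial.coeff (binaryExponent n i) p) = p := by
  ext d
  by_cases hd : d.degree = n
  · have hd' : d 0 + d 1 = n := by simpa [Finsupp.degree_eq_sum] using hd
    have : d = binaryExponent n ((⟨d 0, by omega⟩ : Fin (n + 1)) : ℕ) := by
      ext i
      fin_cases i
      · simp [binaryExponent]
      · simp [binaryExponent]
        omega
    rw [this, coeff_binaryForm]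
  · rw [hp.coeff_eq_zero hd, (isHomogeneous_binaryForm n _).coeff_eq_zero hd]

theorem binaryForm_mulVec (n : ℕ) (g : Matrix (Fin 2) (Fin 2) ℂ) (v : Fin (n + 1) → ℂ) :
    binaryForm n ((symMatrix2 n g).mulVec v) = subst2 g (binaryForm n v) := by
  have hcol (k : Fin (n + 1)) : symPoly2 n g k =
      subst2 g (MvPolynomial.X 0 ^ (k : ℕ) * MvPolynomial.X 1 ^ (n - (k : ℕ))) := by
    simp [symPoly2, subst2]
  have hhom (k : Fin (n + 1)) : (symPoly2 n g k).IsHomogeneous n := by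
    rw [hcol]
    apply isHomogeneous_subst2
    have := (MvPolynomial.isHomogeneous_X_pow (R := ℂ) (0 : Fin 2) (k : ℕ)).mul
      (MvPolynomial.isHomogeneous_X_pow (R := ℂ) (1 : Fin 2) (n - (k : ℕ)))
    rwa [Nat.add_sub_cancel' k.is_le] at this
  have hv : (symMatrix2 n g).mulVec v = ∑ k, v k • fun i : Fin (n + 1) =>
      MvPolynomial.coeff (binaryExponent n i) (symPoly2 n g k) := by
    ext i
    simp [Matrix.mulVec, dotProduct, symMatrix2, binaryExponent, mul_comm]
  rw [hv, map_sum, binaryForm_eq_sum n v, map_sum]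
  refine Finset.sum_congr rfl fun k _ => ?_
  rw [map_smul, binaryForm_coeff (hhom k), map_smul, hcol]

/-- A coefficient vector is invariant iff the corresponding binary form is fixed by all
substitutions from the group. -/
theorem mem_symInvariants2_iff (Γ : Subgroup (SpecialLinearGroup (Fin 2) ℂ)) (n : ℕ)
    (v : Fin (n + 1) → ℂ) : v ∈ symInvariants2 Γ n ↔
      ∀ g ∈ Γ, subst2 (g : Matrix (Fin 2) (Fin 2) ℂ) (binaryForm n v) = binaryForm n v := by
  change (∀ g ∈ Γ, _) ↔ _
  refine forall₂_congr fun g _ => ?_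
  rw [← binaryForm_mulVec, (binaryForm_injective n).eq_iff]

theorem subst2_eq_of_mem_closure {S : Set (SpecialLinearGroup (Fin 2) ℂ)}
    {p : MvPolynomial (Fin 2) ℂ} (hS : ∀ g ∈ S, subst2 (g : Matrix (Fin 2) (Fin 2) ℂ) p = p)
    {g : SpecialLinearGroup (Fin 2) ℂ} (hg : g ∈ Subgroup.closure S) :
    subst2 (g : Matrix (Fin 2) (Fin 2) ℂ) p = p := by
  induction hg using Subgroup.closure_induction with
  | mem g hg => exact hS g hg
  | one => exact subst2_one p
  | mul g h _ _ hg hh =>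
    calc _ = subst2 ((g : Matrix (Fin 2) (Fin 2) ℂ) * (h : Matrix (Fin 2) (Fin 2) ℂ)) p :=
          congrArg (fun M => subst2 M p) (Matrix.SpecialLinearGroup.coe_mul g h)
      _ = p := by rw [← subst2_subst2, hh, hg]
  | inv g _ hg =>
    have hinv : ((g⁻¹ : SpecialLinearGroup (Fin 2) ℂ) : Matrix (Fin 2) (Fin 2) ℂ) *
        (g : Matrix (Fin 2) (Fin 2) ℂ) = 1 :=
      (Matrix.SpecialLinearGroup.coe_mul g⁻¹ g).symm.trans
        (by rw [inv_mul_cancel]; exact Matrix.SpecialLinearGroup.coe_one)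
    calc _ = subst2 ((g⁻¹ : SpecialLinearGroup (Fin 2) ℂ) : Matrix (Fin 2) (Fin 2) ℂ)
            (subst2 (g : Matrix (Fin 2) (Fin 2) ℂ) p) := by rw [hg]
      _ = p := by rw [subst2_subst2, hinv, subst2_one]

theorem eval_homogeneous_axis {n : ℕ} {p : MvPolynomial (Fin 2) ℂ} (hp : p.IsHomogeneous n)
    (z : ℂ) : MvPolynomial.eval ![z, 0] p =
      MvPolynomial.coeff (Finsupp.single 0 n) p * z ^ n := by
  rw [MvPolynomial.eval_eq', Finset.sum_eq_single (Finsupp.single 0 n)]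
  · simp [Fin.prod_univ_two]
  · intro d hd hne
    by_cases h1 : d 1 = 0
    · refine absurd ?_ hne
      have := hp (MvPolynomial.mem_support_iff.mp hd)
      have h0 : d 0 = n := by simpa [Finsupp.weight_apply, Finsupp.sum_fintype, h1] using this
      ext i
      fin_cases i <;> simp [h0, h1]
    · simp [Fin.prod_univ_two, h1]
  · intro h
    simp [MvPolynomial.notMem_support_iff.mp h]

theorem X_one_dvd_of_eval_axis_eq_zero {n : ℕ} {p : MvPolynomial (Fin 2) ℂ}
    (hp : p.IsHomogeneous n) (h : MvPolynomial.eval ![1, 0] p = 0) : MvPolynomial.X 1 ∣ p := by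
  rw [eval_homogeneous_axis hp, one_pow, mul_one] at h
  rw [MvPolynomial.X_dvd_iff_modMonomial_eq_zero]
  ext d
  by_cases hd : Finsupp.single 1 1 ≤ d
  · rw [MvPolynomial.coeff_modMonomial_of_le _ hd, MvPolynomial.coeff_zero]
  · rw [MvPolynomial.coeff_modMonomial_of_not_le _ hd, MvPolynomial.coeff_zero]
    have h1 : d 1 = 0 := by
      by_contra h1
      exact hd (Finsupp.single_le_iff.mpr (by omega))
    by_cases hdeg : d.degree = n
    · convert h
      have h0 : d 0 = n := by simpa [Finsupp.degree_eq_sum, h1] using hdeg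
      ext i
      fin_cases i <;> simp [h0, h1]
    · exact hp.coeff_eq_zero hdeg

/-- The linear form `x + u * y`. -/
noncomputable def linearForm (u : ℂ) : MvPolynomial (Fin 2) ℂ :=
  MvPolynomial.X 0 + MvPolynomial.C u * MvPolynomial.X 1

theorem prime_linearForm (u : ℂ) : Prime (linearForm u) := by
  rw [← irreducible_iff_prime]
  have h := MvPolynomial.irreducible_mul_X_add (1 : MvPolynomial (Fin 2) ℂ)
    (MvPolynomial.C u * MvPolynomial.X 1) 0 one_ne_zero (by simp)
    (fun h => by
      have := MvPolynomial.vars_mul _ _ h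
      simp at this) isRelPrime_one_left
  rwa [one_mul] at h

theorem mul_linearForm_dvd {D p : MvPolynomial (Fin 2) ℂ} {u : ℂ} (hD : D ∣ p)
    (hu : linearForm u ∣ p) (h : MvPolynomial.eval ![-u, 1] D ≠ 0) : D * linearForm u ∣ p := by
  obtain ⟨q, rfl⟩ := hD
  refine mul_dvd_mul_left D (((prime_linearForm u).dvd_or_dvd hu).resolve_left ?_)
  rintro ⟨r, rfl⟩
  simp [linearForm] at h

/-- If `p` is an eigenvector of a substitution, then divisors of `p` are carried to divisors
of `p`. -/
theorem dvd_of_subst2_dvd {g : Matrix (Fin 2) (Fin 2) ℂ} {p l l' : MvPolynomial (Fin 2) ℂ}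
    {e k : ℂ} (he : e ≠ 0) (hp : subst2 g p = MvPolynomial.C e * p) (hl : l ∣ p)
    (hl' : subst2 g l = MvPolynomial.C k * l') : l' ∣ p := by
  have h := map_dvd (subst2 g) hl
  rw [hp, hl'] at h
  have h2 : p = MvPolynomial.C e⁻¹ * (MvPolynomial.C e * p) := by
    rw [← mul_assoc, ← map_mul, inv_mul_cancel₀ he, map_one, one_mul]
  rw [h2]
  exact ((dvd_mul_left _ _).trans h).mul_left _

theorem exists_homogeneous_factor {n m : ℕ} {t p : MvPolynomial (Fin 2) ℂ}
    (ht : t.IsHomogeneous m) (hp : p.IsHomogeneous n) (h : t ∣ p) (hp0 : p ≠ 0) :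
    m ≤ n ∧ ∃ q : MvPolynomial (Fin 2) ℂ, q.IsHomogeneous (n - m) ∧ p = t * q := by
  let _ := MvPolynomial.gradedAlgebra (σ := Fin 2) (R := ℂ)
  obtain ⟨q, rfl⟩ := h
  have ht' : t ∈ MvPolynomial.homogeneousSubmodule (Fin 2) ℂ m := ht
  have hp' : t * q ∈ MvPolynomial.homogeneousSubmodule (Fin 2) ℂ n := hp
  have hdec := DirectSum.decompose_of_mem_same _ hp'
  by_cases hmn : m ≤ n
  · rw [DirectSum.coe_decompose_mul_of_left_mem_of_le _ ht' hmn] at hdec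
    exact ⟨hmn, _, (DirectSum.decompose (MvPolynomial.homogeneousSubmodule (Fin 2) ℂ) q _).2,
      hdec.symm⟩
  · rw [DirectSum.coe_decompose_mul_of_left_mem_of_not_le _ ht' hmn] at hdec
    exact absurd hdec.symm hp0

/-- The matrix `a` of the binary octahedral group, for a primitive eighth root of unity `ζ`. -/
def octA (ζ : ℂ) : Matrix (Fin 2) (Fin 2) ℂ := !![ζ, 0; 0, ζ ^ 7]

/-- The matrix `b` of the binary octahedral group, for a primitive eighth root of unity `ζ`. -/
def octB (ζ : ℂ) : Matrix (Fin 2) (Fin 2) ℂ := !![0, ζ ^ 2; ζ ^ 2, 0]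

/-- The matrix `c` of the binary octahedral group, for a primitive eighth root of unity `ζ`. -/
noncomputable def octC (ζ : ℂ) : Matrix (Fin 2) (Fin 2) ℂ :=
  !![(1 - ζ ^ 2) / 2, (1 - ζ ^ 2) / 2; -(1 + ζ ^ 2) / 2, (1 + ζ ^ 2) / 2]

/-- The binary forms of degree `n` fixed by `octB` and `octC`, and scaled by `ε` by `octA`. -/
def octForms (ζ ε : ℂ) (n : ℕ) : Submodule ℂ (MvPolynomial (Fin 2) ℂ) where
  carrier := {p | p.IsHomogeneous n ∧ subst2 (octA ζ) p = MvPolynomial.C ε * p ∧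
    subst2 (octB ζ) p = p ∧ subst2 (octC ζ) p = p}
  add_mem' := by
    rintro p q ⟨hp, hpa, hpb, hpc⟩ ⟨hq, hqa, hqb, hqc⟩
    exact ⟨hp.add hq, by rw [map_add, hpa, hqa, mul_add], by rw [map_add, hpb, hqb],
      by rw [map_add, hpc, hqc]⟩
  zero_mem' := ⟨MvPolynomial.isHomogeneous_zero _ _ _, by simp, by simp, by simp⟩
  smul_mem' := by
    rintro z p ⟨hp, hpa, hpb, hpc⟩
    exact ⟨by rw [MvPolynomial.smul_eq_C_mul]; exact hp.C_mul z,
      by rw [map_smul, hpa, mul_smul_comm], by rw [map_smul, hpb], by rw [map_smul, hpc]⟩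

theorem mul_mem_octForms {ζ ε ε' : ℂ} {m n : ℕ} {p q : MvPolynomial (Fin 2) ℂ}
    (hp : p ∈ octForms ζ ε m) (hq : q ∈ octForms ζ ε' n) :
    p * q ∈ octForms ζ (ε * ε') (m + n) := by
  obtain ⟨hp, hpa, hpb, hpc⟩ := hp
  obtain ⟨hq, hqa, hqb, hqc⟩ := hq
  refine ⟨hp.mul hq, ?_, by rw [map_mul, hpb, hqb], by rw [map_mul, hpc, hqc]⟩
  rw [map_mul, hpa, hqa, map_mul]
  ring

theorem of_mul_mem_octForms {ζ ε ε' : ℂ} {m n : ℕ} {p q : MvPolynomial (Fin 2) ℂ} (hε : ε ≠ 0)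
    (hp : p ∈ octForms ζ ε m) (hp0 : p ≠ 0) (hpq : p * q ∈ octForms ζ (ε * ε') (m + n))
    (hq : q.IsHomogeneous n) : q ∈ octForms ζ ε' n := by
  obtain ⟨hp, hpa, hpb, hpc⟩ := hp
  obtain ⟨-, hqa, hqb, hqc⟩ := hpq
  rw [map_mul, hpa] at hqa
  rw [map_mul, hpb] at hqb
  rw [map_mul, hpc] at hqc
  refine ⟨hq, ?_, mul_left_cancel₀ hp0 hqb, mul_left_cancel₀ hp0 hqc⟩
  have hC : MvPolynomial.C ε * p ≠ 0 :=
    mul_ne_zero (by simpa using hε) hp0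
  refine mul_left_cancel₀ hC ?_
  rw [hqa, map_mul]
  ring

instance (ζ ε : ℂ) (n : ℕ) : Module.Finite ℂ (octForms ζ ε n) := by
  refine Submodule.finiteDimensional_of_le (S₂ := LinearMap.range (binaryForm n)) ?_
  intro p hp
  exact ⟨_, binaryForm_coeff hp.1⟩

/-- The product of the six linear forms vanishing at the vertices of the octahedron. -/
noncomputable def vertexForm : MvPolynomial (Fin 2) ℂ :=
  MvPolynomial.X 0 * MvPolynomial.X 1 * (MvPolynomial.X 0 ^ 4 - MvPolynomial.X 1 ^ 4)

/-- The form of degree eight vanishing at the face centres of the octahedron. -/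
noncomputable def faceForm : MvPolynomial (Fin 2) ℂ :=
  MvPolynomial.X 0 ^ 8 + MvPolynomial.C 14 * (MvPolynomial.X 0 ^ 4 * MvPolynomial.X 1 ^ 4) +
    MvPolynomial.X 1 ^ 8

/-- The form of degree twelve vanishing at the edge midpoints of the octahedron. -/
noncomputable def edgeForm : MvPolynomial (Fin 2) ℂ :=
  MvPolynomial.X 0 ^ 12 - MvPolynomial.C 33 * (MvPolynomial.X 0 ^ 8 * MvPolynomial.X 1 ^ 4) -
    MvPolynomial.C 33 * (MvPolynomial.X 0 ^ 4 * MvPolynomial.X 1 ^ 8) + MvPolynomial.X 1 ^ 12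

theorem binary_funext {p q : MvPolynomial (Fin 2) ℂ}
    (h : ∀ x y, MvPolynomial.eval ![x, y] p = MvPolynomial.eval ![x, y] q) : p = q :=
  MvPolynomial.funext fun v => by
    have hv : v = ![v 0, v 1] := by ext i; fin_cases i <;> rfl
    rw [hv, h]

theorem isHomogeneous_X_pow_mul_X_pow (i j : ℕ) :
    (MvPolynomial.X 0 ^ i * MvPolynomial.X 1 ^ j : MvPolynomial (Fin 2) ℂ).IsHomogeneous (i + j) :=
  (MvPolynomial.isHomogeneous_X_pow _ _).mul (MvPolynomial.isHomogeneous_X_pow _ _)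

theorem vertexForm_mem {ζ : ℂ} (hζ : ζ ^ 4 = -1) : vertexForm ∈ octForms ζ (-1) 6 := by
  refine ⟨?_, ?_, ?_, ?_⟩
  · exact ((MvPolynomial.isHomogeneous_X _ _).mul (MvPolynomial.isHomogeneous_X _ _)).mul
      ((MvPolynomial.isHomogeneous_X_pow _ 4).sub (MvPolynomial.isHomogeneous_X_pow _ 4))
  all_goals
    refine binary_funext fun x y => ?_
    rw [eval_subst2]
    simp [vertexForm, octA, octB, octC]
    grind

theorem faceForm_mem {ζ : ℂ} (hζ : ζ ^ 4 = -1) : faceForm ∈ octForms ζ 1 8 := by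
  refine ⟨?_, ?_, ?_, ?_⟩
  · exact ((MvPolynomial.isHomogeneous_X_pow _ 8).add
      ((isHomogeneous_X_pow_mul_X_pow 4 4).C_mul 14)).add (MvPolynomial.isHomogeneous_X_pow _ 8)
  all_goals
    refine binary_funext fun x y => ?_
    rw [eval_subst2]
    simp [faceForm, octA, octB, octC]
    grind

theorem edgeForm_mem {ζ : ℂ} (hζ : ζ ^ 4 = -1) : edgeForm ∈ octForms ζ (-1) 12 := by
  refine ⟨?_, ?_, ?_, ?_⟩
  · exact (((MvPolynomial.isHomogeneous_X_pow _ 12).sub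
      ((isHomogeneous_X_pow_mul_X_pow 8 4).C_mul 33)).sub
      ((isHomogeneous_X_pow_mul_X_pow 4 8).C_mul 33)).add (MvPolynomial.isHomogeneous_X_pow _ 12)
  all_goals
    refine binary_funext fun x y => ?_
    rw [eval_subst2]
    simp [edgeForm, octA, octB, octC]
    grind

theorem subst2_octA_linearForm {ζ : ℂ} (hζ : ζ ^ 4 = -1) (u : ℂ) :
    subst2 (octA ζ) (linearForm u) = MvPolynomial.C ζ * linearForm (-ζ ^ 2 * u) := by
  refine binary_funext fun x y => ?_
  rw [eval_subst2]
  simp [linearForm, octA]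
  linear_combination ζ ^ 3 * u * y * hζ

theorem vertexForm_eq {i : ℂ} (hi : i ^ 2 = -1) : vertexForm =
    MvPolynomial.X 1 * linearForm 0 * linearForm 1 * linearForm (-1) * linearForm i *
      linearForm (-i) := by
  refine binary_funext fun x y => ?_
  simp [linearForm, vertexForm]
  grind

theorem vertexForm_dvd {ζ ε : ℂ} (hζ : ζ ^ 4 = -1) (hε : ε ≠ 0) {n : ℕ}
    {p : MvPolynomial (Fin 2) ℂ} (hp : p ∈ octForms ζ ε n)
    (h : MvPolynomial.eval ![1, 0] p = 0) : vertexForm ∣ p := by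
  obtain ⟨hp, hpa, hpb, hpc⟩ := hp
  have hi : (ζ ^ 2) ^ 2 = -1 := by rw [← hζ]; ring
  have hi0 : ζ ^ 2 ≠ 0 := by
    intro h0
    simp [h0] at hi
  have hstep {u u' : ℂ} (hu : linearForm u ∣ p) (huu' : u' = -ζ ^ 2 * u) : linearForm u' ∣ p :=
    huu' ▸ dvd_of_subst2_dvd hε hpa hu (subst2_octA_linearForm hζ u)
  have hy := X_one_dvd_of_eval_axis_eq_zero hp h
  have hx : linearForm 0 ∣ p := by
    refine dvd_of_subst2_dvd (g := octB ζ) (e := 1) (k := ζ ^ 2) one_ne_zero (by simpa using hpb)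
      hy ?_
    rw [subst2_X_one]
    simp [octB, linearForm]
  have hxi : linearForm (ζ ^ 2) ∣ p := by
    refine dvd_of_subst2_dvd (g := octC ζ) (e := 1) (k := (1 - ζ ^ 2) / 2) one_ne_zero
      (by simpa using hpc) hy ?_
    refine binary_funext fun x y => ?_
    rw [eval_subst2]
    simp [linearForm, octC]
    linear_combination y / 2 * hζ
  have hx1 : linearForm 1 ∣ p := hstep hxi (by linear_combination hζ)
  have hxi' : linearForm (-ζ ^ 2) ∣ p := hstep hx1 (by ring)
  have hx1' : linearForm (-1) ∣ p := hstep hxi' (by linear_combination -hζ)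
  rw [vertexForm_eq hi]
  refine mul_linearForm_dvd (mul_linearForm_dvd (mul_linearForm_dvd (mul_linearForm_dvd
    (mul_linearForm_dvd hy hx ?_) hx1 ?_) hx1' ?_) hxi ?_) (by simpa using hxi') ?_
  all_goals
    simp [linearForm]
    try grind

theorem vertexForm_ne_zero : vertexForm ≠ 0 := by
  intro h
  have := congrArg (MvPolynomial.eval ![2, 1]) h
  norm_num [vertexForm] at this

/-- Evaluation at `(1, 0)`, restricted to a space of semi-invariant forms. -/
noncomputable def octEval (ζ ε : ℂ) (n : ℕ) : octForms ζ ε n →ₗ[ℂ] ℂ :=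
  (MvPolynomial.aeval (![1, 0] : Fin 2 → ℂ)).toLinearMap.domRestrict (octForms ζ ε n)

theorem octEval_apply {ζ ε : ℂ} {n : ℕ} (p : octForms ζ ε n) :
    octEval ζ ε n p = MvPolynomial.eval ![1, 0] (p : MvPolynomial (Fin 2) ℂ) := by
  simp [octEval, MvPolynomial.aeval_eq_eval]

theorem map_ker_octEval {ζ ε : ℂ} (hζ : ζ ^ 4 = -1) (hε : ε ≠ 0) {n : ℕ} (hn : 6 ≤ n) :
    (LinearMap.ker (octEval ζ ε n)).map (octForms ζ ε n).subtype =
      (octForms ζ (-ε) (n - 6)).map (LinearMap.mulLeft ℂ vertexForm) := by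
  ext p
  constructor
  · rintro ⟨p, hp, rfl⟩
    rw [SetLike.mem_coe, LinearMap.mem_ker, octEval_apply] at hp
    by_cases hp0 : (p : MvPolynomial (Fin 2) ℂ) = 0
    · exact ⟨0, zero_mem _, by simp [hp0]⟩
    obtain ⟨-, q, hq, hpq⟩ := exists_homogeneous_factor (vertexForm_mem hζ).1 p.2.1
      (vertexForm_dvd hζ hε p.2 hp) hp0
    refine ⟨q, of_mul_mem_octForms (by simp) (vertexForm_mem hζ) vertexForm_ne_zero ?_ hq,
      hpq.symm⟩
    rw [← hpq, Nat.add_sub_cancel' hn, neg_one_mul, neg_neg]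
    exact p.2
  · rintro ⟨q, hq, rfl⟩
    have h := mul_mem_octForms (vertexForm_mem hζ) hq
    rw [Nat.add_sub_cancel' hn, neg_one_mul, neg_neg] at h
    refine ⟨⟨_, h⟩, ?_, rfl⟩
    rw [SetLike.mem_coe, LinearMap.mem_ker, octEval_apply]
    simp [vertexForm]

theorem finrank_ker_octEval {ζ ε : ℂ} (hζ : ζ ^ 4 = -1) (hε : ε ≠ 0) (n : ℕ) :
    Module.finrank ℂ (LinearMap.ker (octEval ζ ε n)) =
      if 6 ≤ n then Module.finrank ℂ (octForms ζ (-ε) (n - 6)) else 0 := by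
  split_ifs with hn
  · rw [← Submodule.finrank_map_subtype_eq, map_ker_octEval hζ hε hn]
    exact (Submodule.equivMapOfInjective _
      (mul_right_injective₀ vertexForm_ne_zero) _).finrank_eq.symm
  · suffices LinearMap.ker (octEval ζ ε n) = ⊥ by rw [this, finrank_bot]
    rw [LinearMap.ker_eq_bot']
    intro p hp
    rw [octEval_apply] at hp
    by_contra hp0
    exact hn (exists_homogeneous_factor (vertexForm_mem hζ).1 p.2.1 (vertexForm_dvd hζ hε p.2 hp)
      (by simpa using hp0)).1

theorem finrank_octForms_of_ne_zero {ζ ε : ℂ} (hζ : ζ ^ 4 = -1) (hε : ε ≠ 0) {n : ℕ}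
    {p : MvPolynomial (Fin 2) ℂ} (hp : p ∈ octForms ζ ε n) (h : MvPolynomial.eval ![1, 0] p ≠ 0) :
    Module.finrank ℂ (octForms ζ ε n) =
      1 + if 6 ≤ n then Module.finrank ℂ (octForms ζ (-ε) (n - 6)) else 0 := by
  rw [← finrank_ker_octEval hζ hε, ← (octEval ζ ε n).finrank_range_add_finrank_ker,
    LinearMap.range_eq_top.mpr, finrank_top, Module.finrank_self]
  refine (LinearMap.surjective_iff_ne_zero).mpr fun h0 => h ?_
  rw [← octEval_apply ⟨p, hp⟩, h0, LinearMap.zero_apply]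

theorem finrank_octForms_of_forall_eq_zero {ζ ε : ℂ} (hζ : ζ ^ 4 = -1) (hε : ε ≠ 0) {n : ℕ}
    (h : ∀ p ∈ octForms ζ ε n, MvPolynomial.eval ![1, 0] p = 0) :
    Module.finrank ℂ (octForms ζ ε n) =
      if 6 ≤ n then Module.finrank ℂ (octForms ζ (-ε) (n - 6)) else 0 := by
  have h0 : octEval ζ ε n = 0 := by
    ext p
    rw [octEval_apply, h p p.2, LinearMap.zero_apply]
  rw [← finrank_ker_octEval hζ hε, h0, LinearMap.ker_zero, finrank_top]

theorem eval_axis_eq_zero_of_pow_ne {ζ ε : ℂ} {n : ℕ} (h : ζ ^ n ≠ ε)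
    {p : MvPolynomial (Fin 2) ℂ} (hp : p ∈ octForms ζ ε n) :
    MvPolynomial.eval ![1, 0] p = 0 := by
  obtain ⟨hp, hpa, -⟩ := hp
  have ha := congrArg (MvPolynomial.eval ![1, 0]) hpa
  rw [eval_subst2, map_mul, MvPolynomial.eval_C] at ha
  have hz : (![octA ζ 0 0 * 1 + octA ζ 1 0 * 0, octA ζ 0 1 * 1 + octA ζ 1 1 * 0] : Fin 2 → ℂ) =
      ![ζ, 0] := by simp [octA]
  rw [hz, eval_homogeneous_axis hp, eval_homogeneous_axis hp, one_pow, mul_one] at ha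
  rw [eval_homogeneous_axis hp, one_pow, mul_one]
  have : (ζ ^ n - ε) * MvPolynomial.coeff (Finsupp.single 0 n) p = 0 := by linear_combination ha
  exact (mul_eq_zero.mp this).resolve_left (sub_ne_zero.mpr h)

/-- There is no nonzero semi-invariant of degree four. -/
theorem eval_axis_eq_zero_of_quartic {ζ : ℂ} (hζ : ζ ^ 4 = -1) {p : MvPolynomial (Fin 2) ℂ}
    (hp : p ∈ octForms ζ (-1) 4) : MvPolynomial.eval ![1, 0] p = 0 := by
  obtain ⟨hp, hpa, hpb, hpc⟩ := hp
  obtain ⟨v, rfl⟩ : ∃ v, binaryForm 4 v = p := ⟨_, binaryForm_coeff hp⟩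
  have hv (x y : ℂ) : MvPolynomial.eval ![x, y] (binaryForm 4 v) =
      v 0 * y ^ 4 + v 1 * x * y ^ 3 + v 2 * x ^ 2 * y ^ 2 + v 3 * x ^ 3 * y + v 4 * x ^ 4 := by
    rw [binaryForm_eq_sum, Fin.sum_univ_five]
    simp [MvPolynomial.smul_eval]
    ring
  have ha (x y : ℂ) := congrArg (MvPolynomial.eval ![x, y]) hpa
  have hb := congrArg (MvPolynomial.eval ![1, 0]) hpb
  have hc := congrArg (MvPolynomial.eval ![1, 0]) hpc
  simp only [eval_subst2, hv, map_mul, MvPolynomial.eval_C] at ha hb hc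
  have ha1 := ha 1 1
  have ha2 := ha 1 (-1)
  have ha3 := ha 1 (ζ ^ 2)
  rw [hv]
  simp [octA, octB, octC] at ha1 ha2 ha3 hb hc ⊢
  grind

theorem faceForm_pow_mem {ζ : ℂ} (hζ : ζ ^ 4 = -1) (k : ℕ) :
    faceForm ^ k ∈ octForms ζ 1 (8 * k) := by
  induction k with
  | zero => exact ⟨MvPolynomial.isHomogeneous_one _ _, by simp, by simp, by simp⟩
  | succ k ih => simpa [pow_succ, mul_add] using mul_mem_octForms ih (faceForm_mem hζ)

theorem pow_eq_pow_mod_eight {ζ : ℂ} (hζ : ζ ^ 4 = -1) (n : ℕ) : ζ ^ n = ζ ^ (n % 8) :=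
  pow_eq_pow_mod n (by linear_combination (ζ ^ 4 - 1) * hζ)

theorem pow_eq_one_iff_mod_eight {ζ : ℂ} (hζ : ζ ^ 4 = -1) (n : ℕ) : ζ ^ n = 1 ↔ n % 8 = 0 := by
  rw [pow_eq_pow_mod_eight hζ]
  have : n % 8 < 8 := Nat.mod_lt _ (by norm_num)
  interval_cases n % 8 <;> simp <;> grind

theorem pow_eq_neg_one_iff_mod_eight {ζ : ℂ} (hζ : ζ ^ 4 = -1) (n : ℕ) :
    ζ ^ n = -1 ↔ n % 8 = 4 := by
  have h := pow_eq_one_iff_mod_eight hζ (n + 4)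
  rw [pow_add, hζ, mul_neg_one, neg_eq_iff_eq_neg] at h
  rw [h]
  omega

theorem finrank_octForms_one {ζ : ℂ} (hζ : ζ ^ 4 = -1) (n : ℕ) :
    Module.finrank ℂ (octForms ζ 1 n) = (if n % 8 = 0 then 1 else 0) +
      if 6 ≤ n then Module.finrank ℂ (octForms ζ (-1) (n - 6)) else 0 := by
  by_cases h8 : n % 8 = 0
  · obtain ⟨k, rfl⟩ := Nat.dvd_of_mod_eq_zero h8
    rw [if_pos h8]
    exact finrank_octForms_of_ne_zero hζ one_ne_zero (faceForm_pow_mem hζ k) (by simp [faceForm])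
  · rw [if_neg h8, zero_add]
    exact finrank_octForms_of_forall_eq_zero hζ one_ne_zero fun p hp =>
      eval_axis_eq_zero_of_pow_ne ((pow_eq_one_iff_mod_eight hζ n).not.mpr h8) hp

theorem finrank_octForms_neg_one {ζ : ℂ} (hζ : ζ ^ 4 = -1) (n : ℕ) :
    Module.finrank ℂ (octForms ζ (-1) n) = (if 12 ≤ n ∧ n % 8 = 4 then 1 else 0) +
      if 6 ≤ n then Module.finrank ℂ (octForms ζ 1 (n - 6)) else 0 := by
  have hε : (-1 : ℂ) ≠ 0 := by simp
  by_cases h : 12 ≤ n ∧ n % 8 = 4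
  · obtain ⟨k, rfl⟩ : ∃ k, n = 12 + 8 * k := ⟨(n - 12) / 8, by omega⟩
    have hmem := mul_mem_octForms (edgeForm_mem hζ) (faceForm_pow_mem hζ k)
    rw [mul_one] at hmem
    rw [if_pos h, finrank_octForms_of_ne_zero hζ hε hmem (by simp [edgeForm, faceForm]), neg_neg]
  · rw [if_neg h, zero_add, finrank_octForms_of_forall_eq_zero hζ hε, neg_neg]
    intro p hp
    by_cases h4 : n = 4
    · subst h4
      exact eval_axis_eq_zero_of_quartic hζ hp
    · exact eval_axis_eq_zero_of_pow_ne
        ((pow_eq_neg_one_iff_mod_eight hζ n).not.mpr (by omega)) hp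

theorem finrank_octForms_one_recurrence {ζ : ℂ} (hζ : ζ ^ 4 = -1) (n : ℕ) :
    Module.finrank ℂ (octForms ζ 1 n) =
      (if n % 8 = 0 then 1 else 0) + (if 18 ≤ n ∧ n % 8 = 2 then 1 else 0) +
        if 12 ≤ n then Module.finrank ℂ (octForms ζ 1 (n - 12)) else 0 := by
  rw [finrank_octForms_one hζ, finrank_octForms_neg_one hζ, Nat.sub_sub,
    show 6 + 6 = 12 from rfl]
  split_ifs <;> omega

theorem invariant_series_of_recurrence {r : ℕ → ℕ}
    (hr : ∀ n, r n = (if n % 8 = 0 then 1 else 0) + (if 18 ≤ n ∧ n % 8 = 2 then 1 else 0) +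
      if 12 ≤ n then r (n - 12) else 0) :
    (1 - PowerSeries.X ^ 8) * (1 - PowerSeries.X ^ 12) *
      PowerSeries.mk (fun n => (r n : ℂ)) = 1 + PowerSeries.X ^ 18 := by
  have h12 : (1 - PowerSeries.X ^ 12) * PowerSeries.mk (fun n => (r n : ℂ)) =
      PowerSeries.mk fun n =>
        (if n % 8 = 0 then 1 else 0) + (if 18 ≤ n ∧ n % 8 = 2 then 1 else 0) := by
    ext n
    rw [sub_mul, one_mul, map_sub, PowerSeries.coeff_X_pow_mul', PowerSeries.coeff_mk,
      PowerSeries.coeff_mk, PowerSeries.coeff_mk, hr n]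
    push_cast
    ring
  rw [mul_assoc, h12]
  ext n
  rw [sub_mul, one_mul, map_sub, PowerSeries.coeff_X_pow_mul', PowerSeries.coeff_mk,
    PowerSeries.coeff_mk, map_add, PowerSeries.coeff_one, PowerSeries.coeff_X_pow]
  split_ifs <;> first | omega | norm_num

theorem map_symInvariants2_closure {ζ : ℂ} (hζ : ζ ^ 4 = -1)
    {S : Set (SpecialLinearGroup (Fin 2) ℂ)}
    (hS : ∀ g : SpecialLinearGroup (Fin 2) ℂ, g ∈ S ↔
      (g : Matrix (Fin 2) (Fin 2) ℂ) = octA ζ ∨ (g : Matrix (Fin 2) (Fin 2) ℂ) = octB ζ ∨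
        (g : Matrix (Fin 2) (Fin 2) ℂ) = octC ζ) (n : ℕ) :
    (symInvariants2 (Subgroup.closure S) n).map (binaryForm n) = octForms ζ 1 n := by
  have hA : (octA ζ).det = 1 := by
    simp [octA, Matrix.det_fin_two]
    linear_combination (ζ ^ 4 - 1) * hζ
  have hB : (octB ζ).det = 1 := by
    simp [octB, Matrix.det_fin_two]
    linear_combination -hζ
  have hC : (octC ζ).det = 1 := by
    simp [octC, Matrix.det_fin_two]
    linear_combination -hζ / 2
  ext p
  constructor
  · rintro ⟨v, hv, rfl⟩
    rw [SetLike.mem_coe, mem_symInvariants2_iff] at hv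
    refine ⟨isHomogeneous_binaryForm n v, ?_, ?_, ?_⟩
    · rw [map_one, one_mul]
      exact hv ⟨octA ζ, hA⟩ (Subgroup.subset_closure ((hS _).mpr (Or.inl rfl)))
    · exact hv ⟨octB ζ, hB⟩ (Subgroup.subset_closure ((hS _).mpr (Or.inr (Or.inl rfl))))
    · exact hv ⟨octC ζ, hC⟩ (Subgroup.subset_closure ((hS _).mpr (Or.inr (Or.inr rfl))))
  · rintro ⟨hp, hpa, hpb, hpc⟩
    refine ⟨_, ?_, binaryForm_coeff hp⟩
    rw [SetLike.mem_coe, mem_symInvariants2_iff, binaryForm_coeff hp]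
    intro g hg
    refine subst2_eq_of_mem_closure ?_ hg
    intro g hg
    rcases (hS g).mp hg with h | h | h
    · rw [map_one, one_mul] at hpa
      exact (congrArg (fun M => subst2 M p) h).trans hpa
    · exact (congrArg (fun M => subst2 M p) h).trans hpb
    · exact (congrArg (fun M => subst2 M p) h).trans hpc

theorem exp_pi_div_four_eq :
    Complex.exp (2 * (Real.pi : ℂ) * Complex.I / 8) = (Real.sqrt 2 : ℂ) / 2 * (1 + Complex.I) := by
  have h : 2 * (Real.pi : ℂ) * Complex.I / 8 = ((Real.pi / 4 : ℝ) : ℂ) * Complex.I := by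
    push_cast
    ring
  rw [h, Complex.exp_mul_I, ← Complex.ofReal_cos, ← Complex.ofReal_sin, Real.cos_pi_div_four,
    Real.sin_pi_div_four]
  push_cast
  ring

/-- The Poincaré series of the invariants of the binary octahedral group `⟨a, b, c⟩ ⊆ SL₂(ℂ)`
(type `E₇`): `(1 − t⁸)(1 − t¹²)·Σₙ dim (Symⁿ(ℂ²))^Γ · tⁿ = 1 + t¹⁸` in `ℂ⟦t⟧`. -/
theorem binary_octahedral_invariant_series
    (ζ : ℂ) (hζ : ζ = Complex.exp (2 * (Real.pi : ℂ) * Complex.I / 8))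
    (a b c : Matrix (Fin 2) (Fin 2) ℂ)
    (hA : a = !![ζ, 0; 0, ζ ^ 7])
    (hB : b = !![0, Complex.I; Complex.I, 0])
    (hC : c = ((Real.sqrt 2 : ℂ))⁻¹ • !![ζ ^ 7, ζ ^ 7; ζ ^ 5, ζ])
    (Γ : Subgroup (SpecialLinearGroup (Fin 2) ℂ))
    (hΓ : Γ = Subgroup.closure {g : SpecialLinearGroup (Fin 2) ℂ |
      (g : Matrix (Fin 2) (Fin 2) ℂ) = a ∨ (g : Matrix (Fin 2) (Fin 2) ℂ) = b ∨
        (g : Matrix (Fin 2) (Fin 2) ℂ) = c}) :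
    (1 - PowerSeries.X ^ 8) * (1 - PowerSeries.X ^ 12) *
        PowerSeries.mk (fun n => (Module.finrank ℂ (symInvariants2 Γ n) : ℂ)) =
      1 + PowerSeries.X ^ 18 := by
  have hs : (Real.sqrt 2 : ℂ) ^ 2 = 2 := by
    rw [← Complex.ofReal_pow, Real.sq_sqrt (by norm_num)]
    norm_num
  have hs0 : (Real.sqrt 2 : ℂ) ≠ 0 := by
    intro h
    simp [h] at hs
  rw [exp_pi_div_four_eq] at hζ
  have hI : ζ ^ 2 = Complex.I := by
    rw [hζ]
    linear_combination (1 + Complex.I) ^ 2 / 4 * hs + Complex.I_sq / 2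
  have h4 : ζ ^ 4 = -1 := by
    rw [show ζ ^ 4 = (ζ ^ 2) ^ 2 by ring, hI, Complex.I_sq]
  have hB' : b = octB ζ := by rw [hB, octB, hI]
  have hC' : c = octC ζ := by
    rw [← hI] at hζ
    rw [hC]
    ext i j
    fin_cases i <;> fin_cases j <;> simp [octC] <;> field_simp <;> grind
  rw [hA, hB', hC', ← octA] at hΓ
  refine invariant_series_of_recurrence fun n => ?_
  have hrank (m : ℕ) : Module.finrank ℂ (symInvariants2 Γ m) =
      Module.finrank ℂ (octForms ζ 1 m) := by
    rw [hΓ, ← map_symInvariants2_closure h4 (fun _ => Iff.rfl) m]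
    exact (Submodule.equivMapOfInjective _ (binaryForm_injective m) _).finrank_eq
  rw [hrank, hrank]
  exact finrank_octForms_one_recurrence h4 n
end

section
/- Let Γ be a finite subgroup of SL₃(ℂ) with natural (inclusion) representation γ on ℂ³ and natural character χ, dual representation γ*, and irreducible representations γ₀, …, γ_l with characters χ₀, …, χ_l. Let A⁽¹⁾, A⁽²⁾ ∈ M_{l+1}(ℕ) have entries a⁽¹⁾_{ij} = multiplicity of γᵢ in γⱼ ⊗ γ and a⁽²⁾_{ij} = multiplicity of γᵢ in γⱼ ⊗ γ*. Then for every g ∈ Γ, the vector w_g := (χ₀(g), …, χ_l(g)) ∈ ℂ^{l+1} satisfies A⁽²⁾·w_g = χ(g)·w_g and A⁽¹⁾·w_g = conj(χ(g))·w_g, where the matrices act via (A·w)ⱼ = Σᵢ a_{ji}·wᵢ. -/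
open Matrix Complex CategoryTheory

open scoped ComplexOrder in
/-- Characters of a finite group over `ℂ` satisfy `χ(g⁻¹) = conj χ(g)`. -/
theorem Representation.character_inv_eq_conj {G V : Type*} [Group G] [Fintype G]
    [AddCommGroup V] [Module ℂ V] [FiniteDimensional ℂ V] (ρ : Representation ℂ G V) (g : G) :
    ρ.character g⁻¹ = (starRingEnd ℂ) (ρ.character g) := by
  classical
  let b := Module.finBasis ℂ V
  let M : G → Matrix (Fin (Module.finrank ℂ V)) (Fin (Module.finrank ℂ V)) ℂ :=
    fun h => LinearMap.toMatrix b b (ρ h)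
  have hmul (x y : G) : M (x * y) = M x * M y := by
    simp [M, LinearMap.toMatrix_mul]
  have hone : M 1 = 1 := by simp [M, LinearMap.toMatrix_one]
  have htr (x : G) : ρ.character x = (M x).trace := LinearMap.trace_eq_matrix_trace ℂ b _
  -- The Gram matrix of a `G`-invariant inner product.
  let P := ∑ h : G, (M h)ᴴ * M h
  have hP : IsUnit P := by
    have hpos : P.PosDef := by
      refine Matrix.posDef_sum ⟨1, Finset.mem_univ _⟩ fun h _ => ?_
      refine Matrix.PosDef.conjTranspose_mul_self _ (Matrix.mulVec_injective_of_isUnit ?_)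
      exact IsUnit.of_mul_eq_one (M h⁻¹) (by rw [← hmul, mul_inv_cancel, hone])
    exact hpos.isUnit
  have hinv : (M g)ᴴ * P = P * M g⁻¹ := by
    simp only [P, Finset.mul_sum, Finset.sum_mul]
    refine Fintype.sum_equiv (Equiv.mulRight g) _ _ fun h => ?_
    rw [Equiv.coe_mulRight, mul_assoc, ← hmul, mul_inv_cancel_right, hmul,
      Matrix.conjTranspose_mul, mul_assoc]
  have hdet : IsUnit P.det := (Matrix.isUnit_iff_isUnit_det P).mp hP
  have hconj : (M g)ᴴ = P * M g⁻¹ * P⁻¹ := by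
    rw [← hinv, Matrix.mul_nonsing_inv_cancel_right _ _ hdet]
  rw [htr, htr, starRingEnd_apply, ← Matrix.trace_conjTranspose, hconj, Matrix.trace_mul_comm,
    Matrix.nonsing_inv_mul_cancel_left _ _ hdet]

/-- The character of a representation is the sum of those of complementary
subrepresentations. -/
theorem Representation.character_eq_add_of_isCompl {k G V : Type*} [Field k] [Monoid G]
    [AddCommGroup V] [Module k V] [FiniteDimensional k V] {ρ : Representation k G V}
    {σ τ : Subrepresentation ρ} (h : IsCompl σ τ) (g : G) :
    ρ.character g = σ.toRepresentation.character g + τ.toRepresentation.character g := by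
  have hc : IsCompl σ.toSubmodule τ.toSubmodule := by
    refine ⟨disjoint_iff.mpr ?_, codisjoint_iff.mpr ?_⟩
    · rw [← Subrepresentation.toSubmodule_inf, h.inf_eq_bot]; rfl
    · rw [← Subrepresentation.toSubmodule_sup, h.sup_eq_top]; rfl
  let N : Bool → Submodule k V := fun b => cond b σ.toSubmodule τ.toSubmodule
  have hN : DirectSum.IsInternal N :=
    (DirectSum.isInternal_submodule_iff_isCompl N (i := true) (j := false) (by simp)
      (by ext b; cases b <;> simp)).mpr hc
  have hf : ∀ b, Set.MapsTo (ρ g) (N b) (N b) := by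
    rintro (_ | _)
    · exact τ.apply_mem_toSubmodule g
    · exact σ.apply_mem_toSubmodule g
  have := LinearMap.trace_eq_sum_trace_restrict hN hf
  rw [Fintype.sum_bool] at this
  exact this

/-- The object of `FDRep` attached to an irreducible representation is simple. -/
theorem FDRep.simple_of_isIrreducible {G V : Type} [Group G] [Fintype G]
    [AddCommGroup V] [Module ℂ V] [FiniteDimensional ℂ V] (ρ : Representation ℂ G V)
    [ρ.IsIrreducible] : Simple (FDRep.of ρ) := by
  classical
  have hne : (Nat.card G : ℂ) ≠ 0 := Nat.cast_ne_zero.mpr Nat.card_pos.ne'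
  have := invertibleOfNonzero hne
  rw [FDRep.simple_iff_char_is_norm_one]
  have h := Representation.char_orthonormal ρ ρ
  rw [if_pos ⟨Representation.Equiv.refl ρ⟩, inv_mul_eq_one₀ hne] at h
  exact h.symm

section CompleteFamily

variable {G ι : Type} [Group G] [Fintype G] [Fintype ι] {γ : ι → FDRep ℂ G}

/-- Every character is a linear combination of the characters of a complete family of
simple representations. -/
theorem Representation.exists_character_eq_sum
    (hcomplete : ∀ W : FDRep ℂ G, Simple W → ∃ i, Nonempty (W ≅ γ i))
    {V : Type} [AddCommGroup V] [Module ℂ V] [FiniteDimensional ℂ V]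
    (ρ : Representation ℂ G V) :
    ∃ c : ι → ℂ, ∀ g, ρ.character g = ∑ i, c i * (γ i).character g := by
  classical
  induction hn : Module.finrank ℂ V using Nat.strong_induction_on generalizing V with
  | _ n ih =>
    rcases subsingleton_or_nontrivial V with hV | hV
    · refine ⟨0, fun g => ?_⟩
      simp [Representation.character, Subsingleton.elim (ρ g) 0]
    by_cases hirr : ρ.IsIrreducible
    · obtain ⟨i, ⟨e⟩⟩ := hcomplete _ (FDRep.simple_of_isIrreducible ρ)
      refine ⟨Pi.single i 1, fun g => ?_⟩
      have h : ρ.character g = (γ i).character g := congrFun (FDRep.char_iso e) g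
      simpa [Pi.single_apply] using h
    · obtain ⟨σ, hbot, htop⟩ : ∃ σ : Subrepresentation ρ, σ ≠ ⊥ ∧ σ ≠ ⊤ := by
        by_contra! h
        refine hirr { exists_pair_ne := ⟨⊥, ⊤, fun h => ?_⟩
                      eq_bot_or_eq_top := fun σ => or_iff_not_imp_left.mpr (h σ) }
        exact bot_ne_top (congrArg Subrepresentation.toSubmodule h : (⊥ : Submodule ℂ V) = ⊤)
      have : NeZero (Nat.card G : ℂ) := ⟨Nat.cast_ne_zero.mpr Nat.card_pos.ne'⟩
      obtain ⟨τ, hστ⟩ := exists_isCompl σ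
      have hlt (υ : Subrepresentation ρ) (hυ : υ ≠ ⊤) :
          Module.finrank ℂ υ.toSubmodule < n := by
        rw [← hn]
        exact Submodule.finrank_lt fun h => hυ (Subrepresentation.toSubmodule_injective h)
      have hτ : τ ≠ ⊤ := fun h => hbot (by simpa [h] using hστ.inf_eq_bot)
      obtain ⟨c, hc⟩ := ih _ (hlt σ htop) σ.toRepresentation rfl
      obtain ⟨d, hd⟩ := ih _ (hlt τ hτ) τ.toRepresentation rfl
      refine ⟨c + d, fun g => ?_⟩
      rw [Representation.character_eq_add_of_isCompl hστ, hc, hd, ← Finset.sum_add_distrib]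
      exact Finset.sum_congr rfl fun i _ => (add_mul _ _ _).symm

/-- The expansion of a character in the irreducible characters, with the multiplicities
as coefficients. -/
theorem Representation.sum_multiplicity_mul_character
    (hsimple : ∀ i, Simple (γ i))
    (hdistinct : ∀ i j, i ≠ j → IsEmpty (γ i ≅ γ j))
    (hcomplete : ∀ W : FDRep ℂ G, Simple W → ∃ i, Nonempty (W ≅ γ i))
    {V : Type} [AddCommGroup V] [Module ℂ V] [FiniteDimensional ℂ V]
    (ρ : Representation ℂ G V) (g : G) :
    ∑ i, ((Fintype.card G : ℂ)⁻¹ * ∑ h : G, (γ i).character h * ρ.character h⁻¹) *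
      (γ i).character g = ρ.character g := by
  classical
  have := invertibleOfNonzero (Nat.cast_ne_zero.mpr Nat.card_pos.ne' : (Nat.card G : ℂ) ≠ 0)
  have horth (i j : ι) : (Fintype.card G : ℂ)⁻¹ *
      ∑ h : G, (γ i).character h * (γ j).character h⁻¹ = if i = j then 1 else 0 := by
    have := hsimple i
    have := hsimple j
    rw [Fintype.card_eq_nat_card, FDRep.char_orthonormal]
    refine if_congr ⟨fun ⟨e⟩ => ?_, fun h => h ▸ ⟨Iso.refl _⟩⟩ rfl rfl
    by_contra hij
    exact (hdistinct i j hij).false e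
  obtain ⟨c, hc⟩ := Representation.exists_character_eq_sum hcomplete ρ
  rw [hc g]
  refine Finset.sum_congr rfl fun i _ => congrArg (· * _) ?_
  calc (Fintype.card G : ℂ)⁻¹ * ∑ h : G, (γ i).character h * ρ.character h⁻¹
      = ∑ j, c j * ((Fintype.card G : ℂ)⁻¹ *
          ∑ h : G, (γ i).character h * (γ j).character h⁻¹) := by
        simp only [hc, Finset.mul_sum]
        rw [Finset.sum_comm]
        exact Finset.sum_congr rfl fun _ _ => Finset.sum_congr rfl fun _ _ => by ring
    _ = c i := by simp [horth]

end CompleteFamily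

/-- The natural representation of a group of matrices of determinant one. -/
noncomputable def Matrix.SpecialLinearGroup.naturalRepresentation {n k : Type*} [Fintype n]
    [DecidableEq n] [Field k] (Γ : Subgroup (SpecialLinearGroup n k)) :
    Representation k Γ (n → k) where
  toFun g := Matrix.toLin' g.1.1
  map_one' := Matrix.toLin'_one
  map_mul' g h := Matrix.toLin'_mul g.1.1 h.1.1

theorem Matrix.SpecialLinearGroup.character_naturalRepresentation {n k : Type*} [Fintype n]
    [DecidableEq n] [Field k] (Γ : Subgroup (SpecialLinearGroup n k)) (g : Γ) :
    (naturalRepresentation Γ).character g = Matrix.trace g.1.1 :=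
  Matrix.trace_toLin'_eq _

/-- Let `Γ` be a finite subgroup of `SL₃(ℂ)` with natural character `χ = (g ↦ tr(g))`,
dual natural character `g ↦ tr(g⁻¹)`, and irreducible complex representations
`γ 0, …, γ l` (pairwise non-isomorphic and complete) with characters `χ₀, …, χ_l`.
Let `A⁽¹⁾, A⁽²⁾` be the tensor-multiplicity matrices of `γ` and `γ*`.  Then for every
`g ∈ Γ` the vector `w_g = (χ₀(g), …, χ_l(g))` satisfies `A⁽²⁾·w_g = χ(g)·w_g` and
`A⁽¹⁾·w_g = conj(χ(g))·w_g`. -/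
theorem sl3_character_vectors_are_eigenvectors
    (Γ : Subgroup (SpecialLinearGroup (Fin 3) ℂ)) [Fintype Γ] (l : ℕ)
    (γ : Fin (l + 1) → FDRep ℂ Γ)
    (hsimple : ∀ i, Simple (γ i))
    (hdistinct : ∀ i j, i ≠ j → IsEmpty (γ i ≅ γ j))
    (hcomplete : ∀ W : FDRep ℂ Γ, Simple W → ∃ i, Nonempty (W ≅ γ i))
    (A₁ A₂ : Matrix (Fin (l + 1)) (Fin (l + 1)) ℂ)
    (hA₁ : ∀ i j, A₁ i j = (Fintype.card Γ : ℂ)⁻¹ *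
      ∑ g : Γ, (γ j).character g * Matrix.trace g.1.1 *
        (starRingEnd ℂ) ((γ i).character g))
    (hA₂ : ∀ i j, A₂ i j = (Fintype.card Γ : ℂ)⁻¹ *
      ∑ g : Γ, (γ j).character g * Matrix.trace (g.1⁻¹).1 *
        (starRingEnd ℂ) ((γ i).character g)) :
    ∀ g : Γ,
      A₂.mulVec (fun i => (γ i).character g) =
        Matrix.trace g.1.1 • (fun i => (γ i).character g) ∧
      A₁.mulVec (fun i => (γ i).character g) =
        (starRingEnd ℂ) (Matrix.trace g.1.1) • (fun i => (γ i).character g) := by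
  intro g
  let nat := SpecialLinearGroup.naturalRepresentation Γ
  have hnat (h : Γ) : Matrix.trace h.1.1 = nat.character h :=
    (SpecialLinearGroup.character_naturalRepresentation Γ h).symm
  have hnat_inv (h : Γ) : Matrix.trace (h.1⁻¹).1 = nat.character h⁻¹ := hnat h⁻¹
  have hconj (i : Fin (l + 1)) (h : Γ) :
      (starRingEnd ℂ) ((γ i).character h) = (γ i).character h⁻¹ :=
    (Representation.character_inv_eq_conj (γ i).ρ h).symm
  have hfd (i : Fin (l + 1)) (h : Γ) :
      Representation.character (γ i).ρ h = (γ i).character h := rfl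
  constructor
  · ext j
    have key := Representation.sum_multiplicity_mul_character hsimple hdistinct hcomplete
      (Representation.tprod (γ j).ρ nat) g
    simp only [Representation.char_tensor, Pi.mul_apply, hfd] at key
    rw [Pi.smul_apply, smul_eq_mul, hnat, mul_comm, ← key]
    rw [Matrix.mulVec, dotProduct]
    refine Finset.sum_congr rfl fun i _ => congrArg (· * (γ i).character g) ?_
    rw [hA₂]
    refine congrArg _ (Finset.sum_congr rfl fun h _ => ?_)
    rw [hconj, hnat_inv]
    ring
  · ext j
    have key := Representation.sum_multiplicity_mul_character hsimple hdistinct hcomplete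
      (Representation.tprod (γ j).ρ nat.dual) g
    simp only [Representation.char_tensor, Pi.mul_apply, hfd, Representation.char_dual,
      inv_inv] at key
    rw [Pi.smul_apply, smul_eq_mul, hnat, ← Representation.character_inv_eq_conj, mul_comm, ← key]
    rw [Matrix.mulVec, dotProduct]
    refine Finset.sum_congr rfl fun i _ => congrArg (· * (γ i).character g) ?_
    rw [hA₁]
    refine congrArg _ (Finset.sum_congr rfl fun h _ => ?_)
    rw [hconj, hnat]
    ring
end
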